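/- Mixed ℓ₂/ℓ₁ error bound for the group lasso with block k-sparse signals: let q > 1 be real, k ≥ 1, x block k-sparse, κ ∈ (0,1), μ > 0, ε with ‖Aᵀε‖_{2,∞} ≤ κμ, and y = A x + ε. Let x̂ be a global minimizer of the group lasso objective z ↦ (1/2)‖y − A z‖₂² + μ‖z‖_{2,1}. Suppose β > 0 is such that ‖A z‖₂ ≥ β·‖z‖_{2,q} for every z with ‖z‖_{2,1} ≤ (2/(1−κ))·k^{1-1/q}·‖z‖_{2,q}. Then ‖x̂ − x‖_{2,1} ≤ ((1+κ)/(1−κ)²)·4·k^{2-2/q}·μ/β². -/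

import Mathlib

open scoped BigOperators

noncomputable section

/-- Mixed ℓ₂/ℓ₁ norm of a block signal: sum of the Euclidean norms of the blocks. -/
def mnorm1 {p n : ℕ} (x : Fin p → EuclideanSpace ℝ (Fin n)) : ℝ := ∑ i, ‖x i‖

/-- Mixed ℓ₂/ℓ_q norm of a block signal. -/
def mnorm {p n : ℕ} (q : ℝ) (x : Fin p → EuclideanSpace ℝ (Fin n)) : ℝ :=
  (∑ i, ‖x i‖ ^ q) ^ (1 / q)

/-- Mixed ℓ₂/ℓ_∞ norm of a block signal: the largest block norm. -/
def mnormInf {p n : ℕ} (x : Fin p → EuclideanSpace ℝ (Fin n)) : ℝ := ⨆ i, ‖x i‖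

theorem mnorm_nonneg {p n : ℕ} (q : ℝ) (z : Fin p → EuclideanSpace ℝ (Fin n)) :
    0 ≤ mnorm q z := by
  unfold mnorm
  positivity

/-- Hölder's inequality for the block norms supported on a small set of blocks. -/
theorem sum_norm_le_rpow_mul_mnorm {p n : ℕ} {q : ℝ} (hq : 1 < q) {k : ℕ}
    (S : Finset (Fin p)) (hS : S.card ≤ k) (z : Fin p → EuclideanSpace ℝ (Fin n)) :
    ∑ i ∈ S, ‖z i‖ ≤ (k : ℝ) ^ (1 - 1 / q) * mnorm q z := by
  have hconj : q.HolderConjugate (q / (q - 1)) := Real.HolderConjugate.conjExponent hq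
  have hexp : 1 / (q / (q - 1)) = 1 - 1 / q := by
    have : q ≠ 0 := by linarith
    have : q - 1 ≠ 0 := by linarith
    field_simp
  have hle : 0 ≤ 1 - 1 / q := by
    rw [← hexp]
    have : 0 < q - 1 := by linarith
    positivity
  have h := Real.inner_le_Lp_mul_Lq_of_nonneg S hconj (f := fun i => ‖z i‖) (g := fun _ => 1)
    (fun _ _ => norm_nonneg _) (fun _ _ => zero_le_one)
  simp only [mul_one, Real.one_rpow, Finset.sum_const, nsmul_eq_mul, hexp] at h
  have hsum : (∑ i ∈ S, ‖z i‖ ^ q) ^ (1 / q) ≤ mnorm q z := by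
    unfold mnorm
    apply Real.rpow_le_rpow (by positivity) _ (by positivity)
    exact Finset.sum_le_sum_of_subset_of_nonneg (Finset.subset_univ S)
      fun _ _ _ => by positivity
  have hcard : (S.card : ℝ) ^ (1 - 1 / q) ≤ (k : ℝ) ^ (1 - 1 / q) :=
    Real.rpow_le_rpow (by positivity) (by exact_mod_cast hS) hle
  calc ∑ i ∈ S, ‖z i‖ ≤ (∑ i ∈ S, ‖z i‖ ^ q) ^ (1 / q) * (S.card : ℝ) ^ (1 - 1 / q) := h
    _ ≤ mnorm q z * (k : ℝ) ^ (1 - 1 / q) :=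
        mul_le_mul hsum hcard (by positivity) (mnorm_nonneg q z)
    _ = _ := mul_comm _ _

theorem norm_le_mnormInf {p n : ℕ} (z : Fin p → EuclideanSpace ℝ (Fin n)) (i : Fin p) :
    ‖z i‖ ≤ mnormInf z :=
  le_ciSup (f := fun i => ‖z i‖) (Set.finite_range _).bddAbove i

/-- Duality between the mixed `ℓ₂/ℓ_∞` and `ℓ₂/ℓ₁` norms. -/
theorem inner_le_mnormInf_mul_mnorm1 {p n : ℕ}
    (u v : PiLp 2 (fun _ : Fin p => EuclideanSpace ℝ (Fin n))) :
    inner ℝ u v ≤ mnormInf u * mnorm1 v := by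
  rw [PiLp.inner_apply, mnorm1, Finset.mul_sum]
  refine Finset.sum_le_sum fun i _ => (real_inner_le_norm _ _).trans ?_
  exact mul_le_mul_of_nonneg_right (norm_le_mnormInf u i) (norm_nonneg _)

/-- Comparison of the mixed `ℓ₂/ℓ₁` norms of a signal supported on `S` and of a perturbation. -/
theorem mnorm1_add_mnorm1_sub_le {p n : ℕ} (S : Finset (Fin p))
    (x z : Fin p → EuclideanSpace ℝ (Fin n)) (hx : ∀ i ∉ S, x i = 0) :
    mnorm1 x + mnorm1 (z - x) ≤ mnorm1 z + 2 * ∑ i ∈ S, ‖(z - x) i‖ := by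
  have hS : ∑ i ∈ S, ‖(z - x) i‖ = ∑ i, if i ∈ S then ‖(z - x) i‖ else 0 := by
    simp
  rw [hS, mnorm1, mnorm1, mnorm1, Finset.mul_sum, ← Finset.sum_add_distrib,
    ← Finset.sum_add_distrib]
  refine Finset.sum_le_sum fun i _ => ?_
  by_cases hi : i ∈ S
  · have h := norm_sub_norm_le (x i) (z i)
    rw [norm_sub_rev] at h
    simp only [hi, if_true, Pi.sub_apply]
    linarith
  · simp [hi, hx i hi]

/-- Mixed ℓ₂/ℓ₁ error bound for the group lasso with block k-sparse signals. -/
theorem stmt_10 {p n m : ℕ}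
    (A : PiLp 2 (fun _ : Fin p => EuclideanSpace ℝ (Fin n)) →L[ℝ] EuclideanSpace ℝ (Fin m))
    (q : ℝ) (hq : 1 < q) (k : ℕ) (hk : 1 ≤ k)
    (x : PiLp 2 (fun _ : Fin p => EuclideanSpace ℝ (Fin n)))
    (hx : ∃ S : Finset (Fin p), S.card ≤ k ∧ ∀ i ∉ S, x i = 0)
    (κ : ℝ) (hκ0 : 0 < κ) (hκ1 : κ < 1)
    (μ : ℝ) (hμ : 0 < μ)
    (ε : EuclideanSpace ℝ (Fin m))
    (hε : mnormInf (ContinuousLinearMap.adjoint A ε) ≤ κ * μ)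
    (y : EuclideanSpace ℝ (Fin m)) (hy : y = A x + ε)
    (xh : PiLp 2 (fun _ : Fin p => EuclideanSpace ℝ (Fin n)))
    (hmin : ∀ z : PiLp 2 (fun _ : Fin p => EuclideanSpace ℝ (Fin n)),
      (1 / 2) * ‖y - A xh‖ ^ 2 + μ * mnorm1 xh ≤ (1 / 2) * ‖y - A z‖ ^ 2 + μ * mnorm1 z)
    (β : ℝ) (hβ : 0 < β)
    (hcmsv : ∀ z : PiLp 2 (fun _ : Fin p => EuclideanSpace ℝ (Fin n)),
      mnorm1 z ≤ (2 / (1 - κ)) * (k : ℝ) ^ (1 - 1 / q) * mnorm q z → β * mnorm q z ≤ ‖A z‖) :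
    mnorm1 (xh - x) ≤ ((1 + κ) / (1 - κ) ^ 2) * 4 * (k : ℝ) ^ (2 - 2 / q) * μ / β ^ 2 := by
  obtain ⟨S, hS, hxS⟩ := hx
  set h := xh - x with hh
  have hK : (k : ℝ) ^ (2 - 2 / q) = ((k : ℝ) ^ (1 - 1 / q)) ^ 2 := by
    rw [← Real.rpow_natCast, ← Real.rpow_mul (by positivity)]
    congr 1
    push_cast
    ring
  have hcone : mnorm1 x + mnorm1 h ≤ mnorm1 xh + 2 * ∑ i ∈ S, ‖h i‖ :=
    mnorm1_add_mnorm1_sub_le S x xh hxS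
  have hholder := sum_norm_le_rpow_mul_mnorm hq S hS h
  have h1 : 0 ≤ mnorm1 h := Finset.sum_nonneg fun _ _ => norm_nonneg _
  have hinner : inner ℝ ε (A h) ≤ κ * μ * mnorm1 h := by
    rw [← ContinuousLinearMap.adjoint_inner_left]
    exact (inner_le_mnormInf_mul_mnorm1 _ _).trans (mul_le_mul_of_nonneg_right hε h1)
  have hres : y - A xh = ε - A h := by
    rw [hy, hh, map_sub]
    abel
  have hopt := hmin x
  rw [hres, norm_sub_sq_real, hy, add_sub_cancel_left] at hopt
  rw [hK]
  set K := (k : ℝ) ^ (1 - 1 / q)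
  have hmain : (1 / 2) * ‖A h‖ ^ 2 + (1 - κ) * μ * mnorm1 h ≤ 2 * μ * (K * mnorm q h) := by
    have := mul_le_mul_of_nonneg_left hcone hμ.le
    have := mul_le_mul_of_nonneg_left hholder hμ.le
    linarith
  have hκ : 0 < 1 - κ := by linarith
  have hbound : mnorm1 h ≤ 2 / (1 - κ) * K * mnorm q h := by
    have h2 : μ * ((1 - κ) * mnorm1 h) ≤ μ * (2 * (K * mnorm q h)) := by
      linarith [sq_nonneg ‖A h‖]
    have h3 := le_of_mul_le_mul_left h2 hμ
    rw [div_mul_eq_mul_div, div_mul_eq_mul_div, le_div_iff₀ hκ]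
    linarith
  have hA := hcmsv h hbound
  have hsq : (β * mnorm q h) ^ 2 ≤ ‖A h‖ ^ 2 :=
    pow_le_pow_left₀ (mul_nonneg hβ.le (mnorm_nonneg q h)) hA 2
  have hfin : (1 - κ) * mnorm1 h * β ^ 2 ≤ 2 * μ * K ^ 2 := by
    have h2 : μ * ((1 - κ) * mnorm1 h * β ^ 2) ≤ μ * (2 * μ * K ^ 2) := by
      have := mul_le_mul_of_nonneg_right hmain (sq_nonneg β)
      have := mul_le_mul_of_nonneg_right hsq (sq_nonneg β)
      linarith [sq_nonneg (β ^ 2 * mnorm q h - 2 * μ * K)]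
    exact le_of_mul_le_mul_left h2 hμ
  have heq : (1 + κ) / (1 - κ) ^ 2 * 4 * K ^ 2 * μ / β ^ 2
      = (1 + κ) * 4 * K ^ 2 * μ / ((1 - κ) ^ 2 * β ^ 2) := by
    field_simp
  change mnorm1 h ≤ _
  rw [heq, le_div_iff₀ (by positivity)]
  have h2 := mul_le_mul_of_nonneg_left hfin hκ.le
  have h3 : 0 ≤ κ * (μ * K ^ 2) := by positivity
  have h4 : 0 ≤ μ * K ^ 2 := by positivity
  linarith
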